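/- Every three-directional path on n vertices admits a planar direction-consistent embedding on every set of n points in convex position in general position. That is, if P = d_1,...,d_{n-1} has all its edge labels in some three-element subset T of {U,D,L,R}, and S is any set of n points in convex position with no three collinear and no two sharing an x- or y-coordinate, then there is a bijection E from the vertices of P to S such that the straight-line drawing is crossing-free and every edge points in the direction prescribed by its label. -/

import Mathlib

/-- Edge direction labels. -/
inductive Dir | U | D | L | R
deriving DecidableEq

/-- Opposite label: U↔D, L↔R. -/
def Dir.opp : Dir → Dir
  | .U => .D | .D => .U | .L => .R | .R => .L

/-- Label after counterclockwise rotation by π/2: U↦L, D↦R, R↦U, L↦D. -/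
def Dir.rot : Dir → Dir
  | .U => .L | .D => .R | .R => .U | .L => .D

/-- Label after vertical-line reflection: U↦U, D↦D, R↦L, L↦R. -/
def Dir.mir : Dir → Dir
  | .U => .U | .D => .D | .R => .L | .L => .R

/-- An edge from `a` to `b` is consistent with a direction label. -/
def dirOk : Dir → ℝ × ℝ → ℝ × ℝ → Prop
  | .U, a, b => a.2 < b.2
  | .D, a, b => b.2 < a.2
  | .R, a, b => a.1 < b.1
  | .L, a, b => b.1 < a.1

/-- The drawing of a path with edge labels `d` and vertex placement `E` is
direction-consistent. -/
def DirConsistent {m : ℕ} (d : Fin m → Dir) (E : Fin (m + 1) → ℝ × ℝ) : Prop :=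
  ∀ i : Fin m, dirOk (d i) (E i.castSucc) (E i.succ)

/-- The straight-line drawing of the path with vertex placement `E` is planar:
non-adjacent segments are disjoint; adjacent segments meet only at the shared endpoint. -/
def PlanarDrawing {m : ℕ} (E : Fin (m + 1) → ℝ × ℝ) : Prop :=
  (∀ i j : Fin m, (i : ℕ) + 1 < (j : ℕ) →
    segment ℝ (E i.castSucc) (E i.succ) ∩ segment ℝ (E j.castSucc) (E j.succ) = ∅) ∧
  (∀ i j : Fin m, (i : ℕ) + 1 = (j : ℕ) →
    segment ℝ (E i.castSucc) (E i.succ) ∩ segment ℝ (E j.castSucc) (E j.succ) = {E i.succ})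

/-- `E` is an embedding of the path vertices onto the point set `S`. -/
def EmbOn {m : ℕ} (E : Fin (m + 1) → ℝ × ℝ) (S : Set (ℝ × ℝ)) : Prop :=
  Function.Injective E ∧ Set.range E = S

/-- Planar direction-consistent embedding of the labeled path `d` on `S`. -/
def PDCE {m : ℕ} (d : Fin m → Dir) (E : Fin (m + 1) → ℝ × ℝ) (S : Set (ℝ × ℝ)) : Prop :=
  EmbOn E S ∧ DirConsistent d E ∧ PlanarDrawing E

/-- `S` is in convex position. -/
def ConvexPos (S : Set (ℝ × ℝ)) : Prop :=
  ConvexIndependent ℝ ((↑) : S → ℝ × ℝ)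

/-- No three distinct points of `S` are collinear. -/
def NoThreeCollinear (S : Set (ℝ × ℝ)) : Prop :=
  ∀ p ∈ S, ∀ q ∈ S, ∀ r ∈ S, p ≠ q → p ≠ r → q ≠ r →
    ¬ Collinear ℝ ({p, q, r} : Set (ℝ × ℝ))

/-- General position: no three collinear, no two points with equal x- or y-coordinate. -/
def GenPos (S : Set (ℝ × ℝ)) : Prop :=
  NoThreeCollinear S ∧ ∀ p ∈ S, ∀ q ∈ S, p ≠ q → p.1 ≠ q.1 ∧ p.2 ≠ q.2

def IsTopmost (S : Set (ℝ × ℝ)) (t : ℝ × ℝ) : Prop :=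
  t ∈ S ∧ ∀ p ∈ S, p ≠ t → p.2 < t.2
def IsBottommost (S : Set (ℝ × ℝ)) (b : ℝ × ℝ) : Prop :=
  b ∈ S ∧ ∀ p ∈ S, p ≠ b → b.2 < p.2
def IsLeftmost (S : Set (ℝ × ℝ)) (l : ℝ × ℝ) : Prop :=
  l ∈ S ∧ ∀ p ∈ S, p ≠ l → l.1 < p.1
def IsRightmost (S : Set (ℝ × ℝ)) (r : ℝ × ℝ) : Prop :=
  r ∈ S ∧ ∀ p ∈ S, p ≠ r → p.1 < r.1

/-- Cross product telling on which side of the directed line `a → b` the point `p` lies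
(`0 < cross a b p` means `p` is strictly to the left). -/
def cross (a b p : ℝ × ℝ) : ℝ :=
  (b.1 - a.1) * (p.2 - a.2) - (b.2 - a.2) * (p.1 - a.1)

/-- With `b` bottommost and `t` topmost, all other points lie strictly to the left of the
line through `b` and `t`. -/
def LeftSided (S : Set (ℝ × ℝ)) (b t : ℝ × ℝ) : Prop :=
  IsBottommost S b ∧ IsTopmost S t ∧ ∀ p ∈ S, p ≠ b → p ≠ t → 0 < cross b t p

/-- With `b` bottommost and `t` topmost, all other points lie strictly to the right of the
line through `b` and `t`. -/
def RightSided (S : Set (ℝ × ℝ)) (b t : ℝ × ℝ) : Prop :=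
  IsBottommost S b ∧ IsTopmost S t ∧ ∀ p ∈ S, p ≠ b → p ≠ t → cross b t p < 0

/-- Two points of `S` are consecutive on the convex hull of `S`: all other points of `S`
lie strictly on one side of the line through them. -/
def HullConsecutive (S : Set (ℝ × ℝ)) (p q : ℝ × ℝ) : Prop :=
  p ∈ S ∧ q ∈ S ∧ p ≠ q ∧
    ((∀ r ∈ S, r ≠ p → r ≠ q → 0 < cross p q r) ∨
     (∀ r ∈ S, r ≠ p → r ≠ q → cross p q r < 0))

/-- Strip-convex point set with bottommost `b`, leftmost `l`, topmost `t`, rightmost `r`: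
`b` and `l` coincide or are hull-consecutive, and so do `t` and `r`. -/
def StripConvex (S : Set (ℝ × ℝ)) (b l t r : ℝ × ℝ) : Prop :=
  IsBottommost S b ∧ IsLeftmost S l ∧ IsTopmost S t ∧ IsRightmost S r ∧
    (b = l ∨ HullConsecutive S b l) ∧ (t = r ∨ HullConsecutive S t r)

/-- `T` is a consecutive subset of the convex point set `S` along its hull:
it can be separated from `S \ T` by a line. -/
def Consecutive (S T : Set (ℝ × ℝ)) : Prop :=
  T ⊆ S ∧ ∃ f : (ℝ × ℝ) →ₗ[ℝ] ℝ, ∃ c : ℝ,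
    (∀ p ∈ T, c < f p) ∧ ∀ p ∈ S \ T, f p < c

/-- The coordinate function that must increase along an edge with a given label. -/
def labelValue (X Y : ℤ → ℝ) : Dir → ℤ → ℝ
  | .U => Y
  | .D => fun i => -Y i
  | .R => X
  | .L => fun i => -X i

/-- `IntervalPath F w lo hi v`: some path whose labels, read from the last edge to the first,
are `w` visits the integer interval `[lo, hi]` and ends at `v`, each step entering a new
integer adjacent to the interval visited so far and increasing the value `F d` of its label. -/
inductive IntervalPath (F : Dir → ℤ → ℝ) : List Dir → ℤ → ℤ → ℤ → Prop
  | single (a : ℤ) : IntervalPath F [] a a a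
  | up {w : List Dir} {lo hi v : ℤ} (d : Dir) (h : IntervalPath F w lo hi v)
      (hd : F d v < F d (hi + 1)) : IntervalPath F (d :: w) lo (hi + 1) (hi + 1)
  | down {w : List Dir} {lo hi v : ℤ} (d : Dir) (h : IntervalPath F w lo hi v)
      (hd : F d v < F d (lo - 1)) : IntervalPath F (d :: w) (lo - 1) hi (lo - 1)

namespace IntervalPath

variable {F G : Dir → ℤ → ℝ} {w : List Dir} {lo hi v : ℤ}

lemma bounds (h : IntervalPath F w lo hi v) : lo ≤ v ∧ v ≤ hi ∧ hi - lo = w.length := by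
  induction h with
  | single a => simp
  | up d h hd ih => simp only [List.length_cons]; push_cast; omega
  | down d h hd ih => simp only [List.length_cons]; push_cast; omega

lemma up_to {hi' : ℤ} (d : Dir) (h : IntervalPath F w lo hi v) (e : hi' = hi + 1)
    (hd : F d v < F d hi') : IntervalPath F (d :: w) lo hi' hi' := by
  subst e; exact h.up d hd

lemma down_to {lo' : ℤ} (d : Dir) (h : IntervalPath F w lo hi v) (e : lo' = lo - 1)
    (hd : F d v < F d lo') : IntervalPath F (d :: w) lo' hi lo' := by
  subst e; exact h.down d hd

lemma shift (h : IntervalPath F w lo hi v) (k : ℤ) (hFG : ∀ d i, G d (i + k) = F d i) :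
    IntervalPath G w (lo + k) (hi + k) (v + k) := by
  induction h with
  | single a => exact .single _
  | up d h hd ih => exact ih.up_to d (by ring) (by simpa only [hFG] using hd)
  | down d h hd ih => exact ih.down_to d (by ring) (by simpa only [hFG] using hd)

lemma reflect (h : IntervalPath F w lo hi v) (φ : Dir → Dir) (k : ℤ)
    (hFG : ∀ d i, G (φ d) (k - i) = F d i) :
    IntervalPath G (w.map φ) (k - hi) (k - lo) (k - v) := by
  induction h with
  | single a => exact .single _
  | up d h hd ih => exact ih.down_to _ (by ring) (by simpa only [hFG] using hd)
  | down d h hd ih => exact ih.up_to _ (by ring) (by simpa only [hFG] using hd)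

/-- If every label value attains its maximum over subintervals only at an endpoint, any word
can be realized. -/
lemma exists_of_valley (F : Dir → ℤ → ℝ) (w : List Dir) (lo hi : ℤ)
    (hlen : hi - lo = w.length)
    (hinj : ∀ d ∈ w, ∀ i j, lo ≤ i → i < j → j ≤ hi → F d i ≠ F d j)
    (hval : ∀ d ∈ w, ∀ i j k, lo ≤ i → i < j → j < k → k ≤ hi →
      F d j < max (F d i) (F d k)) :
    ∃ v, IntervalPath F w lo hi v := by
  induction w generalizing lo hi with
  | nil =>
    obtain rfl : hi = lo := by simpa [sub_eq_zero] using hlen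
    exact ⟨_, .single _⟩
  | cons d w ih =>
    simp only [List.length_cons] at hlen
    push_cast at hlen
    have hlt : lo < hi := by omega
    rcases lt_or_gt_of_ne (hinj d (by simp) lo hi le_rfl hlt le_rfl) with h | h
    · obtain ⟨v, hv⟩ := ih lo (hi - 1) (by omega)
        (fun d hd i j a b c => hinj d (by simp [hd]) i j a b (by omega))
        (fun d hd i j k a b c e => hval d (by simp [hd]) i j k a b c (by omega))
      obtain ⟨h1, h2, -⟩ := hv.bounds
      refine ⟨hi, hv.up_to d (by ring) ?_⟩
      rcases h1.eq_or_lt with rfl | h1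
      · exact h
      · simpa [max_eq_right h.le] using hval d (by simp) lo v hi le_rfl h1 (by omega) le_rfl
    · obtain ⟨v, hv⟩ := ih (lo + 1) hi (by omega)
        (fun d hd i j a b c => hinj d (by simp [hd]) i j (by omega) b c)
        (fun d hd i j k a b c e => hval d (by simp [hd]) i j k (by omega) b c e)
      obtain ⟨h1, h2, -⟩ := hv.bounds
      refine ⟨lo, hv.down_to d (by ring) ?_⟩
      rcases h2.eq_or_lt with rfl | h2
      · exact h
      · simpa [max_eq_left h.le] using hval d (by simp) lo v hi le_rfl (by omega) h2 le_rfl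

/-- Extend a path to a larger interval when the label values increase away from it. -/
lemma extend (h : IntervalPath F w lo hi v) (c : Dir) (u : List Dir) (lo' hi' : ℤ)
    (hlo : lo' ≤ lo) (hhi : hi ≤ hi') (hlen : (lo - lo') + (hi' - hi) = u.length + 1)
    (hc : ∀ i, (lo' ≤ i ∧ i < lo) ∨ (hi < i ∧ i ≤ hi') → F c v < F c i)
    (hmono : ∀ d ∈ u, ∀ i j, hi < i → i < j → j ≤ hi' → F d i < F d j)
    (hanti : ∀ d ∈ u, ∀ i j, lo' ≤ i → i < j → j < lo → F d j < F d i)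
    (hne : ∀ d ∈ u, ∀ i j, lo' ≤ i → i < lo → hi < j → j ≤ hi' → F d i ≠ F d j) :
    ∃ v', IntervalPath F (u ++ c :: w) lo' hi' v' ∧
      ((lo' ≤ v' ∧ v' < lo) ∨ (hi < v' ∧ v' ≤ hi')) := by
  induction u generalizing lo' hi' with
  | nil =>
    simp only [List.length_nil, Nat.cast_zero, zero_add] at hlen
    rcases hlo.eq_or_lt with rfl | hlo
    · exact ⟨hi', h.up_to c (by omega) (hc _ (by omega)), by omega⟩
    · obtain rfl : hi = hi' := by omega
      exact ⟨lo', h.down_to c (by omega) (hc _ (by omega)), by omega⟩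
  | cons d u ih =>
    simp only [List.length_cons] at hlen
    push_cast at hlen
    by_cases hup : hi < hi' ∧ (lo' < lo → F d lo' < F d hi')
    · obtain ⟨v', hv', hm⟩ := ih lo' (hi' - 1) hlo (by omega) (by omega)
        (fun i hi => hc i (by omega))
        (fun d hd i j a b c => hmono d (by simp [hd]) i j a b (by omega))
        (fun d hd i j a b c => hanti d (by simp [hd]) i j a b c)
        (fun d hd i j a b c e => hne d (by simp [hd]) i j a b c (by omega))
      refine ⟨hi', hv'.up_to d (by ring) ?_, by omega⟩
      rcases hm with ⟨h1, h2⟩ | ⟨h1, h2⟩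
      · rcases h1.eq_or_lt with rfl | h1
        · exact hup.2 h2
        · exact (hanti d (by simp) _ _ le_rfl h1 h2).trans (hup.2 (by omega))
      · exact hmono d (by simp) _ _ h1 (by omega) le_rfl
    · have hl : lo' < lo := by
        by_contra hl
        exact hup ⟨by omega, fun h => absurd h hl⟩
      have hmx : hi < hi' → F d hi' < F d lo' := by
        intro hh
        rcases lt_or_gt_of_ne (hne d (by simp) lo' hi' le_rfl hl hh le_rfl) with h1 | h1
        · exact absurd ⟨hh, fun _ => h1⟩ hup
        · exact h1
      obtain ⟨v', hv', hm⟩ := ih (lo' + 1) hi' (by omega) hhi (by omega)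
        (fun i hi => hc i (by omega))
        (fun d hd i j a b c => hmono d (by simp [hd]) i j a b c)
        (fun d hd i j a b c => hanti d (by simp [hd]) i j (by omega) b c)
        (fun d hd i j a b c e => hne d (by simp [hd]) i j (by omega) b c e)
      refine ⟨lo', hv'.down_to d (by ring) ?_, by omega⟩
      rcases hm with ⟨h1, h2⟩ | ⟨h1, h2⟩
      · exact hanti d (by simp) _ _ le_rfl (by omega) h2
      · rcases h2.eq_or_lt with rfl | h2
        · exact hmx h1
        · exact (hmono d (by simp) _ _ h1 h2 le_rfl).trans (hmx (by omega))

/-- Concatenate a path with the reverse of a path on the complementary cyclic interval. -/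
lemma glue {n : ℤ} (hper : ∀ d i, F d (i + n) = F d i) {w₂ : List Dir} {lo₂ hi₂ v₂ : ℤ}
    (h₂ : IntervalPath (fun d i => -F d i) w₂ lo₂ hi₂ v₂) (d : Dir)
    (h : IntervalPath F w lo hi v) (hlo : lo₂ = hi + 1) (hhi : hi₂ = lo + n - 1)
    (hd : F d v < F d v₂) :
    ∃ lo' hi' v', IntervalPath F (w₂.reverse ++ d :: w) lo' hi' v' := by
  induction h₂ generalizing w lo hi v d with
  | single a => exact ⟨_, _, _, h.up_to d hlo hd⟩
  | up e h' he ih =>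
    obtain ⟨lo', hi', v', hr⟩ := ih e (h.down_to (lo' := lo - 1) d rfl (by
      rw [← hper d (lo - 1)]; convert hd using 2; omega)) hlo (by omega) (by
        rw [← hper e (lo - 1), sub_add_eq_add_sub, ← hhi]
        simpa using he)
    exact ⟨lo', hi', v', by simpa using hr⟩
  | down e h' he ih =>
    obtain ⟨lo', hi', v', hr⟩ := ih e (h.up_to d hlo hd) (by omega) hhi (by simpa using he)
    exact ⟨lo', hi', v', by simpa using hr⟩

/-- An enumeration of the vertices of an interval path in path order. -/
lemma exists_enumeration (h : IntervalPath F w lo hi v) :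
    ∃ q : ℕ → ℤ, q w.length = v ∧ (∀ i ≤ w.length, lo ≤ q i ∧ q i ≤ hi) ∧
      (∀ j ≤ w.length, ∃ a b, ∀ i ≤ w.length, (a ≤ q i ∧ q i ≤ b) ↔ i ≤ j) ∧
      (∀ j, ∀ hj : j < w.reverse.length,
        F (w.reverse[j]) (q j) < F (w.reverse[j]) (q (j + 1))) := by
  have advance : ∀ {w : List Dir} {lo hi v lo' hi' v' : ℤ} (d : Dir)
      (_ : F d v < F d v') (_ : lo' ≤ lo) (_ : hi ≤ hi') (_ : lo' ≤ v' ∧ v' ≤ hi')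
      (_ : v' < lo ∨ hi < v'),
      (∃ q : ℕ → ℤ, q w.length = v ∧ (∀ i ≤ w.length, lo ≤ q i ∧ q i ≤ hi) ∧
        (∀ j ≤ w.length, ∃ a b, ∀ i ≤ w.length, (a ≤ q i ∧ q i ≤ b) ↔ i ≤ j) ∧
        (∀ j, ∀ hj : j < w.reverse.length,
          F (w.reverse[j]) (q j) < F (w.reverse[j]) (q (j + 1)))) →
      (∃ q : ℕ → ℤ, q (d :: w).length = v' ∧
        (∀ i ≤ (d :: w).length, lo' ≤ q i ∧ q i ≤ hi') ∧
        (∀ j ≤ (d :: w).length, ∃ a b, ∀ i ≤ (d :: w).length, (a ≤ q i ∧ q i ≤ b) ↔ i ≤ j) ∧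
        (∀ j, ∀ hj : j < (d :: w).reverse.length,
          F ((d :: w).reverse[j]) (q j) < F ((d :: w).reverse[j]) (q (j + 1)))) := by
    rintro w lo hi v lo' hi' v' d hd h1 h2 h3 h4 ⟨q, hq, hb, hp, hl⟩
    have hold : ∀ i ≤ w.length, Function.update q (w.length + 1) v' i = q i := fun i hi =>
      Function.update_of_ne (by omega) _ _
    have hnew : Function.update q (w.length + 1) v' (w.length + 1) = v' :=
      Function.update_self _ _ _
    refine ⟨Function.update q (w.length + 1) v', by simp, ?_, ?_, ?_⟩
    · intro i hi
      rcases Nat.lt_or_ge w.length i with h | h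
      · obtain rfl : i = w.length + 1 := by simp at hi; omega
        rw [hnew]; exact h3
      · rw [hold i h]; have := hb i h; omega
    · intro j hj
      rcases Nat.lt_or_ge w.length j with h | h
      · refine ⟨lo', hi', fun i hi => ⟨fun _ => by simp at hi; omega, fun _ => ?_⟩⟩
        rcases Nat.lt_or_ge w.length i with h | h
        · obtain rfl : i = w.length + 1 := by simp at hi; omega
          rw [hnew]; exact h3
        · rw [hold i h]; have := hb i h; omega
      · obtain ⟨a, b, hab⟩ := hp j h
        refine ⟨max a lo, min b hi, fun i hi => ?_⟩
        rcases Nat.lt_or_ge w.length i with h' | h'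
        · obtain rfl : i = w.length + 1 := by simp at hi; omega
          rw [hnew]; omega
        · rw [hold i h']
          have := hb i h'
          have := hab i h'
          omega
    · intro j hj
      simp only [List.reverse_cons, List.length_append, List.length_reverse, List.length_cons,
        List.length_nil] at hj
      rcases Nat.lt_or_ge j w.length with h | h
      · rw [hold j (by omega), hold (j + 1) (by omega)]
        simp only [List.reverse_cons]
        rw [List.getElem_append_left (by simpa using h)]
        exact hl j (by simpa using h)
      · obtain rfl : j = w.length := by omega
        rw [hold _ le_rfl, hnew, hq]
        simpa using hd
  induction h with
  | single a =>
    exact ⟨fun _ => a, rfl, by simp, fun j _ => ⟨a, a, fun i hi => iff_of_true ⟨le_rfl, le_rfl⟩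
      ((Nat.le_zero.1 hi).trans_le j.zero_le)⟩, by simp⟩
  | up d h hd ih =>
    have := h.bounds
    exact advance d hd (by omega) (by omega) (by omega) (by omega) ih
  | down d h hd ih =>
    have := h.bounds
    exact advance d hd (by omega) (by omega) (by omega) (by omega) ih

end IntervalPath

/-- Selecting the `k` smallest values from two sequences increasing away from an interval. -/
lemma exists_interval_of_smallest (X : ℤ → ℝ) (lo hi lo' hi' : ℤ) (hlo : lo' ≤ lo)
    (hhi : hi ≤ hi')
    (hmono : ∀ i j, hi < i → i < j → j ≤ hi' → X i < X j)
    (hanti : ∀ i j, lo' ≤ i → i < j → j < lo → X j < X i)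
    (hne : ∀ i j, lo' ≤ i → i < lo → hi < j → j ≤ hi' → X i ≠ X j)
    (k : ℕ) (hk : (k : ℤ) ≤ (lo - lo') + (hi' - hi)) :
    ∃ u w, lo' ≤ u ∧ u ≤ lo ∧ hi ≤ w ∧ w ≤ hi' ∧ (lo - u) + (w - hi) = k ∧
      ∀ i j, (u ≤ i ∧ i < lo) ∨ (hi < i ∧ i ≤ w) →
        (lo' ≤ j ∧ j < u) ∨ (w < j ∧ j ≤ hi') → X i < X j := by
  induction k with
  | zero => exact ⟨lo, hi, by simp; grind⟩
  | succ k ih =>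
    obtain ⟨u, w, h1, h2, h3, h4, h5, h6⟩ := ih (by push_cast at hk; omega)
    push_cast at hk
    by_cases hup : w < hi' ∧ (lo' < u → X (w + 1) < X (u - 1))
    · refine ⟨u, w + 1, h1, h2, by omega, by omega, by push_cast; omega, fun i j hi hj => ?_⟩
      rcases eq_or_ne i (w + 1) with rfl | hne'
      · rcases hj with hj | hj
        · rcases eq_or_ne j (u - 1) with rfl | hj'
          · exact hup.2 (by omega)
          · exact (hup.2 (by omega)).trans (hanti _ _ hj.1 (by omega) (by omega))
        · exact hmono _ _ (by omega) (by omega) hj.2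
      · exact h6 i j (by omega) (by omega)
    · have hl : lo' < u := by
        by_contra hl
        exact hup ⟨by omega, fun h => absurd h hl⟩
      have hmx : w < hi' → X (u - 1) < X (w + 1) := by
        intro hh
        rcases lt_or_gt_of_ne (hne (u - 1) (w + 1) (by omega) (by omega) (by omega)
          (by omega)) with h | h
        · exact h
        · exact absurd ⟨hh, fun _ => h⟩ hup
      refine ⟨u - 1, w, by omega, by omega, by omega, by omega, by push_cast; omega,
        fun i j hi hj => ?_⟩
      rcases eq_or_ne i (u - 1) with rfl | hne'
      · rcases hj with hj | hj
        · exact hanti _ _ hj.1 (by omega) (by omega)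
        · rcases eq_or_ne j (w + 1) with rfl | hj'
          · exact hmx (by omega)
          · exact (hmx (by omega)).trans (hmono _ _ (by omega) (by omega) hj.2)
      · exact h6 i j (by omega) (by omega)

/-- Periodic coordinate functions of points enumerated clockwise along a convex polygon from
the bottommost point `0`, through the leftmost point `l`, the topmost point `t` and the
rightmost point `r`, back to the bottommost point `n`. -/
structure HullCoords (n l t r : ℤ) (X Y : ℤ → ℝ) : Prop where
  t_pos : 0 < t
  t_lt : t < n
  l_nonneg : 0 ≤ l
  l_le : l ≤ t
  le_r : t ≤ r
  r_le : r ≤ n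
  perX : ∀ i, X (i + n) = X i
  perY : ∀ i, Y (i + n) = Y i
  injX : ∀ i j, i < j → j < i + n → X i ≠ X j
  injY : ∀ i j, i < j → j < i + n → Y i ≠ Y j
  monoY : ∀ i j, 0 ≤ i → i < j → j ≤ t → Y i < Y j
  antiY : ∀ i j, t - n ≤ i → i < j → j ≤ 0 → Y j < Y i
  monoX : ∀ i j, l ≤ i → i < j → j ≤ r → X i < X j
  antiX : ∀ i j, r - n ≤ i → i < j → j ≤ l → X j < X i

namespace HullCoords

variable {n l t r : ℤ} {X Y : ℤ → ℝ}

lemma half_turn (h : HullCoords n l t r X Y) :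
    HullCoords n (r - t) (n - t) (l + n - t) (fun i => -X (i + t)) (fun i => -Y (i + t)) := by
  obtain ⟨h1, h2, h3, h4, h5, h6, pX, pY, iX, iY, mY, aY, mX, aX⟩ := h
  refine ⟨by omega, by omega, by omega, by omega, by omega, by omega, fun i => ?_, fun i => ?_,
    fun i j a b => ?_, fun i j a b => ?_, fun i j a b c => ?_, fun i j a b c => ?_,
    fun i j a b c => ?_, fun i j a b c => ?_⟩
  · simp only [add_right_comm i n t, pX]
  · simp only [add_right_comm i n t, pY]
  · simpa using iX (i + t) (j + t) (by omega) (by omega)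
  · simpa using iY (i + t) (j + t) (by omega) (by omega)
  · have := aY (i + t - n) (j + t - n) (by omega) (by omega) (by omega)
    rw [← pY (i + t - n), ← pY (j + t - n)] at this
    simpa using this
  · simpa using mY (i + t) (j + t) (by omega) (by omega) (by omega)
  · have := aX (i + t - n) (j + t - n) (by omega) (by omega) (by omega)
    rw [← pX (i + t - n), ← pX (j + t - n)] at this
    simpa using this
  · simpa using mX (i + t) (j + t) (by omega) (by omega) (by omega)

lemma flip (h : HullCoords n l t r X Y) :
    HullCoords n (t - l) t (n + t - r) (fun i => X (t - i)) (fun i => -Y (t - i)) := by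
  obtain ⟨h1, h2, h3, h4, h5, h6, pX, pY, iX, iY, mY, aY, mX, aX⟩ := h
  refine ⟨by omega, by omega, by omega, by omega, by omega, by omega, fun i => ?_, fun i => ?_,
    fun i j a b => ?_, fun i j a b => ?_, fun i j a b c => ?_, fun i j a b c => ?_,
    fun i j a b c => ?_, fun i j a b c => ?_⟩
  · rw [← pX (t - (i + n))]; congr 1; ring
  · rw [← pY (t - (i + n))]; congr 2; ring
  · exact (iX (t - j) (t - i) (by omega) (by omega)).symm
  · simpa using (iY (t - j) (t - i) (by omega) (by omega)).symm
  · simpa using mY (t - j) (t - i) (by omega) (by omega) (by omega)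
  · have := aY (t - j - n) (t - i - n) (by omega) (by omega) (by omega)
    rw [← pY (t - j - n), ← pY (t - i - n)] at this
    simpa using this
  · have := aX (t - j) (t - i) (by omega) (by omega) (by omega)
    simpa using this
  · have := mX (t - j) (t - i) (by omega) (by omega) (by omega)
    simpa using this

lemma labelValue_periodic (h : HullCoords n l t r X Y) (d : Dir) (i : ℤ) :
    labelValue X Y d (i + n) = labelValue X Y d i := by
  cases d <;> simp [labelValue, h.perX, h.perY]

lemma labelValue_ne (h : HullCoords n l t r X Y) (d : Dir) (i j : ℤ) (hij : i < j)
    (hji : j < i + n) : labelValue X Y d i ≠ labelValue X Y d j := by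
  cases d <;> simp [labelValue, h.injX i j hij hji, h.injY i j hij hji]

/-- The points to the left of the bottommost point follow it directly in clockwise order. -/
lemma exists_left_count (h : HullCoords n l t r X Y) :
    ∃ f : ℕ, (f : ℤ) < n ∧ ∀ i, 1 ≤ i → i < n → (X i < X 0 ↔ i ≤ f) := by
  have hdown : ∀ i j, 1 ≤ i → i < j → j < n → X j < X 0 → X i < X 0 := by
    intro i j hi hij hj hX
    by_cases h1 : i ≤ l
    · exact h.antiX 0 i (by linarith [h.r_le]) (by omega) h1
    · by_cases h2 : j ≤ r
      · exact (h.monoX i j (by omega) hij h2).trans hX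
      · have := h.antiX (j - n) 0 (by omega) (by omega) h.l_nonneg
        rw [← h.perX (j - n), sub_add_cancel] at this
        exact absurd this hX.not_gt
  have key : ∀ m : ℕ, (m : ℤ) < n →
      ∃ f : ℕ, f ≤ m ∧ ∀ i, 1 ≤ i → i ≤ (m : ℤ) → (X i < X 0 ↔ i ≤ f) := by
    intro m
    induction m with
    | zero => exact fun _ => ⟨0, le_rfl, fun i h1 h2 => by simp at h2; omega⟩
    | succ m ih =>
      intro hm
      push_cast at hm
      by_cases hX : X (m + 1) < X 0
      · refine ⟨m + 1, le_rfl, fun i h1 h2 => iff_of_true ?_ h2⟩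
        push_cast at h2
        rcases h2.eq_or_lt with rfl | h2
        · exact hX
        · exact hdown i _ h1 h2 hm hX
      · obtain ⟨f, hf, hf'⟩ := ih (by omega)
        refine ⟨f, by omega, fun i h1 h2 => ?_⟩
        push_cast at h2
        rcases h2.eq_or_lt with rfl | h2
        · exact iff_of_false hX (by omega)
        · exact hf' i h1 (by omega)
  obtain ⟨f, hf, hf'⟩ := key (n - 1).toNat (by have := h.t_pos; have := h.t_lt; omega)
  have := h.t_pos
  have := h.t_lt
  exact ⟨f, by omega, fun i h1 h2 => hf' i h1 (by omega)⟩

/-- The labels `w`, read backwards from the bottommost point, end with a downward edge or with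
a rightward edge leaving one of the `f` points to the left of it. -/
def EntersBottom (f : ℕ) (w : List Dir) : Prop :=
  ∀ d w', w = d :: w' → d = .D ∨ (d = .R ∧ w.length ≤ f)

/-- A word that can enter the bottommost point is realized on the clockwise interval
starting there. -/
lemma exists_path_to_bottom (h : HullCoords n l t r X Y) {f : ℕ}
    (hf : ∀ i, 1 ≤ i → i < n → (X i < X 0 ↔ i ≤ f)) {w : List Dir} (hL : .L ∉ w)
    (hw : EntersBottom f w) (hlen : (w.length : ℤ) < t) :
    IntervalPath (labelValue X Y) w 0 w.length 0 := by
  have ht := h.t_lt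
  cases w with
  | nil => exact .single 0
  | cons d w =>
    simp only [List.length_cons] at hlen
    push_cast at hlen
    obtain ⟨v, hv⟩ := IntervalPath.exists_of_valley (labelValue X Y) w 1 (w.length + 1) (by ring)
      (fun d _ i j a b c => h.labelValue_ne d i j b (by omega)) (by
        intro d hd i j k a b c e
        cases d with
        | U => exact lt_max_of_lt_right (h.monoY j k (by omega) c (by omega))
        | D => exact lt_max_of_lt_left (neg_lt_neg (h.monoY i j (by omega) b (by omega)))
        | L => simp_all
        | R =>
          by_cases hj : j ≤ l
          · exact lt_max_of_lt_left (h.antiX i j (by have := h.r_le; omega) b hj)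
          · exact lt_max_of_lt_right (h.monoX j k (by omega) c (by have := h.le_r; omega)))
    obtain ⟨h1, h2, -⟩ := hv.bounds
    have := hv.down_to (lo' := 0) d (by ring) (by
      rcases hw d w rfl with rfl | ⟨rfl, hle⟩
      · exact neg_lt_neg (h.monoY 0 v le_rfl (by omega) (by omega))
      · simp only [List.length_cons] at hle
        exact (hf v (by omega) (by omega)).2 (by omega))
    simpa using this

/-- After the bottommost point, a run of upward edges is realized in order of height. -/
lemma exists_path_up (h : HullCoords n l t r X Y) {f : ℕ}
    (hf : ∀ i, 1 ≤ i → i < n → (X i < X 0 ↔ i ≤ f)) {w : List Dir} (hL : .L ∉ w)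
    (hw : EntersBottom f w) {u v : ℤ} (hu : u ≤ 0) (hut : t - n < u) (hv : w.length ≤ v)
    (hvt : v < t) (a : ℕ) (ha : -u + (v - w.length) = a) :
    ∃ x, IntervalPath (labelValue X Y) (List.replicate a .U ++ w) u v x ∧
      (x = 0 ∨ (u ≤ x ∧ x < 0) ∨ (w.length < x ∧ x ≤ v)) := by
  have h0 := h.exists_path_to_bottom hf hL hw (by omega)
  have ht := h.t_lt
  have htp := h.t_pos
  rcases a with _ | a
  · obtain rfl : u = 0 := by omega
    obtain rfl : v = w.length := by omega
    exact ⟨0, by simpa using h0, Or.inl rfl⟩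
  · have hU : ∀ d ∈ List.replicate a Dir.U, d = .U := fun d hd => List.eq_of_mem_replicate hd
    obtain ⟨x, hx, hm⟩ := h0.extend .U (List.replicate a .U) u v hu hv (by simp; omega)
      (by
        intro i hi
        rcases hi with hi | hi
        · exact h.antiY i 0 (by omega) hi.2 le_rfl
        · exact h.monoY 0 i le_rfl (by omega) (by omega))
      (by
        intro d hd i j b c e
        obtain rfl := hU d hd
        exact h.monoY i j (by omega) c (by omega))
      (by
        intro d hd i j b c e
        obtain rfl := hU d hd
        exact h.antiY i j (by omega) c (by omega))
      (fun d _ i j b c e g => h.labelValue_ne d i j (by omega) (by omega))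
    refine ⟨x, ?_, Or.inr hm⟩
    rw [List.replicate_succ', List.append_assoc]
    exact hx

/-- The mirror image of `exists_path_up` at the topmost point. -/
lemma exists_path_down (h : HullCoords n l t r X Y) {f : ℕ}
    (hf : ∀ i, 1 ≤ i → i < n → (-X (i + t) < -X (0 + t) ↔ i ≤ f)) {w : List Dir} (hL : .L ∉ w)
    (hw : EntersBottom f w) {u v : ℤ} (hu : u ≤ t) (hu0 : 0 < u) (hv : t + w.length ≤ v)
    (hvn : v < n) (a : ℕ) (ha : t - u + (v - t - w.length) = a) :
    ∃ x, IntervalPath (fun d i => -labelValue X Y d i) (List.replicate a .U ++ w) u v x ∧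
      (x = t ∨ (u ≤ x ∧ x < t) ∨ (t + w.length < x ∧ x ≤ v)) := by
  obtain ⟨x, hx, hm⟩ := h.half_turn.exists_path_up hf hL hw (u := u - t) (v := v - t)
    (by omega) (by omega) (by omega) (by omega) a (by omega)
  have := hx.shift (G := fun d i => -labelValue X Y d i) t
    (fun d i => by cases d <;> simp [labelValue])
  rw [sub_add_cancel, sub_add_cancel] at this
  exact ⟨x + t, this, by omega⟩

/-- Split off the part of a word beyond its first label that can enter the bottommost point. -/
lemma exists_split (f : ℕ) (w : List Dir) (hL : .L ∉ w) :
    ∃ x y, w = x ++ y ∧ EntersBottom f y ∧ (∀ d ∈ x, d = .U ∨ d = .R) ∧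
      ∀ x₁ x₂, x = x₁ ++ .R :: x₂ → f ≤ x₂.length + y.length := by
  induction w with
  | nil => exact ⟨[], [], rfl, by simp [EntersBottom], by simp, by simp⟩
  | cons d w ih =>
    by_cases hd : d = .D ∨ (d = .R ∧ w.length + 1 ≤ f)
    · refine ⟨[], d :: w, rfl, ?_, by simp, by simp⟩
      rintro d' w' h
      obtain ⟨rfl, rfl⟩ := List.cons.inj h
      simpa using hd
    · obtain ⟨x, y, rfl, hy, hx, hR⟩ := ih (by simp_all)
      refine ⟨d :: x, y, rfl, hy, ?_, ?_⟩
      · intro e he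
        rcases List.mem_cons.1 he with rfl | he
        · cases e <;> simp_all
        · exact hx e he
      · rintro x₁ x₂ hxx
        rcases x₁ with _ | ⟨e, x₁⟩
        · obtain ⟨rfl, rfl⟩ := List.cons.inj hxx
          simp at hd
          omega
        · exact hR x₁ x₂ (List.cons.inj hxx).2

/-- A word in `U` and `R` has no, one, or at least two occurrences of `R`. -/
lemma ur_cases (q : List Dir) (hq : ∀ d ∈ q, d = .U ∨ d = .R) :
    q = List.replicate q.length .U ∨
    (∃ a b, q = List.replicate a .U ++ .R :: List.replicate b .U) ∨
    ∃ a m b, q = List.replicate a .U ++ .R :: (m ++ .R :: List.replicate b .U) := by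
  induction q with
  | nil => simp
  | cons d q ih =>
    rcases hq d (by simp) with rfl | rfl <;>
      rcases ih (fun d hd => hq d (by simp [hd])) with h | ⟨a, b, h⟩ | ⟨a, m, b, h⟩
    · exact .inl (by rw [List.length_cons, List.replicate_succ, ← h])
    · exact .inr (.inl ⟨a + 1, b, by rw [h]; rfl⟩)
    · exact .inr (.inr ⟨a + 1, m, b, by rw [h]; rfl⟩)
    · exact .inr (.inl ⟨0, q.length, by rw [← h]; rfl⟩)
    · exact .inr (.inr ⟨0, List.replicate a .U, b, by rw [h]; rfl⟩)
    · exact .inr (.inr ⟨0, List.replicate a .U ++ .R :: m, b, by rw [h]; simp⟩)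

lemma l_lt_of_gt_left_count (h : HullCoords n l t r X Y) {f : ℕ}
    (hf : ∀ i, 1 ≤ i → i < n → (X i < X 0 ↔ i ≤ f)) {i : ℤ} (hi : 1 ≤ i) (hfi : f < i)
    (hin : i < n) : l < i := by
  by_contra! hl
  have := (hf i hi hin).1 (h.antiX 0 i (by have := h.r_le; omega) (by omega) hl)
  omega

lemma r_lt_of_gt_right_count (h : HullCoords n l t r X Y) {f : ℕ}
    (hf : ∀ i, 1 ≤ i → i < n → (-X (i + t) < -X (0 + t) ↔ i ≤ f)) {i : ℤ} (hi : i < 0)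
    (hfi : t - n + f < i) : r - n < i := by
  by_contra! hl
  have := h.t_pos
  have h1 := (hf (i + n - t) (by omega) (by omega)).1 (by
    simpa using h.monoX t (i + n) h.l_le (by omega) (by omega))
  omega

/-- The core construction: the two ends of the path are placed around the bottommost and the
topmost point, and the labels `q` between these (in reverse order) are only `U` and `R`. -/
lemma exists_path_of_middle (h : HullCoords n l t r X Y) {f f' : ℕ}
    (hf : ∀ i, 1 ≤ i → i < n → (X i < X 0 ↔ i ≤ f))
    (hf' : ∀ i, 1 ≤ i → i < n → (-X (i + t) < -X (0 + t) ↔ i ≤ f'))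
    {w w' q : List Dir} (hL : .L ∉ w) (hL' : .L ∉ w')
    (hw : EntersBottom f w) (hw' : EntersBottom f' w')
    (hwt : (w.length : ℤ) < t) (hwt' : (w'.length : ℤ) < n - t)
    (hlen : (w.length : ℤ) + q.length + w'.length + 1 = n)
    (hq : ∀ d ∈ q, d = .U ∨ d = .R)
    (hR : ∀ q₂ q₁, q = q₂ ++ .R :: q₁ → f ≤ q₁.length + w.length ∧
      f' ≤ q₂.length + w'.length ∧ (f : ℤ) < t ∧ (f' : ℤ) < n - t) :
    ∃ lo hi v, IntervalPath (labelValue X Y) (w'.reverse ++ (q ++ w)) lo hi v := by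
  have htp := h.t_pos
  have htn := h.t_lt
  have hlt := h.l_le
  have hl0 := h.l_nonneg
  have htr := h.le_r
  have hrn := h.r_le
  have hl := fun i => h.l_lt_of_gt_left_count hf (i := i)
  have hr := fun i => h.r_lt_of_gt_right_count hf' (i := i)
  have hYt : ∀ x, t - n < x → x < t → Y x < Y t := by
    intro x h1 h2
    by_cases hx : 0 ≤ x
    · exact h.monoY x t hx h2 le_rfl
    · have := h.antiY (t - n) x le_rfl h1 (by omega)
      rwa [← h.perY (t - n), sub_add_cancel] at this
  have horizontal : ∀ (m : List Dir) (a z : ℕ), (∀ d ∈ m, d = .U ∨ d = .R) →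
      f ≤ a + w.length → f' ≤ z + w'.length → (f : ℤ) < t → (f' : ℤ) < n - t →
      ∀ k : ℕ, (w.length : ℤ) + a + k + z + w'.length + 2 = n →
      (∀ w₁ : List Dir, (w₁ = m ∧ k = 0 ∧ m = []) ∨ (w₁ = m ++ [.R] ∧ k = m.length + 1) →
      ∃ lo hi v, IntervalPath (labelValue X Y) ((List.replicate z Dir.U ++ w').reverse ++
        .R :: (w₁ ++ (List.replicate a .U ++ w))) lo hi v) := by
    intro m a z hm haf hzf hft hft' k hk w₁ hw₁
    obtain ⟨c, hc⟩ : ∃ c : ℤ, c = max (w.length : ℤ) f := ⟨_, rfl⟩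
    obtain ⟨c', hc'⟩ : ∃ c' : ℤ, c' = max (w'.length : ℤ) f' := ⟨_, rfl⟩
    have hXt : X 0 < X t := by
      rcases lt_or_gt_of_ne (h.injX 0 t htp (by omega)) with h1 | h1
      · exact h1
      · have := (hf t (by omega) htn).1 h1
        omega
    have mono : ∀ i j, c < i → i < j → j ≤ t → X i < X j := fun i j h1 h2 h3 =>
      h.monoX i j (hl i (by omega) (by omega) (by omega)).le h2 (by omega)
    have anti : ∀ i j, t - n + c' + 1 ≤ i → i < j → j ≤ 0 → X j < X i := fun i j h1 h2 h3 =>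
      h.antiX i j (hr i (by omega) (by omega)).le h2 (by omega)
    have gap_up : ∀ i, c < i → i < t → X 0 < X i ∧ X i < X t := by
      intro i h1 h2
      refine ⟨?_, mono i t h1 h2 le_rfl⟩
      rcases lt_or_gt_of_ne (h.injX 0 i (by omega) (by omega)) with h3 | h3
      · exact h3
      · have := (hf i (by omega) (by omega)).1 h3
        omega
    have gap_down : ∀ i, t - n + c' + 1 ≤ i → i < 0 → X 0 < X i ∧ X i < X t := by
      intro i h1 h2
      refine ⟨anti i 0 h1 h2 le_rfl, ?_⟩
      rcases lt_or_gt_of_ne (h.injX i t (by omega) (by omega)) with h3 | h3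
      · exact h3
      · have := (hf' (i + n - t) (by omega) (by omega)).1 (by simpa [h.perX] using h3)
        omega
    obtain ⟨u₁, v₁, a1, a2, a3, a4, a5, a6⟩ := exists_interval_of_smallest X 0 c
      (t - n + c' + 1) (t - 1) (by omega) (by omega)
      (fun i j b1 b2 b3 => mono i j b1 b2 (by omega))
      (fun i j b1 b2 b3 => anti i j b1 b2 b3.le)
      (fun i j b1 b2 b3 b4 => h.injX i j (by omega) (by omega))
      (a + w.length - c).toNat (by omega)
    obtain ⟨u₂, v₂, b1, b2, b3, b4, b5, b6⟩ := exists_interval_of_smallest X u₁ v₁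
      (t - n + c' + 1) (t - 1) (by omega) (by omega)
      (fun i j b1 b2 b3 => mono i j (by omega) b2 (by omega))
      (fun i j b1 b2 b3 => anti i j b1 b2 (by omega))
      (fun i j b1 b2 b3 b4 => h.injX i j (by omega) (by omega)) k (by omega)
    obtain ⟨x, hx, hxm⟩ := h.exists_path_up hf hL hw (u := u₁) (v := v₁) a2 (by omega)
      (by omega) (by omega) a (by omega)
    obtain ⟨y, hy, hym⟩ := h.exists_path_down hf' hL' hw' (u := v₂ + 1) (v := u₂ + n - 1)
      (by omega) (by omega) (by omega) (by omega) z (by omega)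
    have hxX : ∀ j, (t - n + c' + 1 ≤ j ∧ j < u₁) ∨ (v₁ < j ∧ j < t) → X x < X j := by
      intro j hj
      by_cases hx1 : (u₁ ≤ x ∧ x < 0) ∨ (c < x ∧ x ≤ v₁)
      · exact a6 x j hx1 (by omega)
      · have : X 0 < X j := by
          rcases hj with hj | hj
          · exact (gap_down j (by omega) (by omega)).1
          · exact (gap_up j (by omega) (by omega)).1
        rcases hxm with rfl | hxm | hxm
        · exact this
        · omega
        · exact ((hf x (by omega) (by omega)).2 (by omega)).trans this
    have hxt : X x < X t := by
      rcases hxm with rfl | hxm | hxm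
      · exact hXt
      · exact (gap_down x (by omega) (by omega)).2
      · by_cases hcx : c < x
        · exact (gap_up x hcx (by omega)).2
        · exact ((hf x (by omega) (by omega)).2 (by omega)).trans hXt
    have hyX : ∀ s, X s < X t → (∀ j, (t - n + c' + 1 ≤ j ∧ j < u₂) ∨ (v₂ < j ∧ j < t) →
        X s < X j) → X s < X y := by
      intro s hst hs
      rcases hym with rfl | hym | hym
      · exact hst
      · exact hs y (by omega)
      · by_cases hcy : t + c' + 1 ≤ y
        · rw [← sub_add_cancel y n, h.perX]
          exact hs _ (by omega)
        · have := (hf' (y - t) (by omega) (by omega)).2 (by omega)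
          simp at this
          exact hst.trans this
    rcases hw₁ with ⟨rfl, rfl, rfl⟩ | ⟨rfl, rfl⟩
    · obtain rfl : u₂ = u₁ := by omega
      obtain rfl : v₂ = v₁ := by omega
      exact IntervalPath.glue h.labelValue_periodic hy .R hx rfl rfl (hyX x hxt hxX)
    · obtain ⟨s, hs, hsm⟩ := hx.extend .R m u₂ v₂ (by omega) (by omega) (by push_cast at b5; omega)
        (fun i hi => hxX i (by omega))
        (by
          intro d hd i j c1 c2 c3
          rcases hm d hd with rfl | rfl
          · exact h.monoY i j (by omega) c2 (by omega)
          · exact mono i j (by omega) c2 (by omega))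
        (by
          intro d hd i j c1 c2 c3
          rcases hm d hd with rfl | rfl
          · exact h.antiY i j (by omega) c2 (by omega)
          · exact anti i j (by omega) c2 (by omega))
        (fun d _ i j c1 c2 c3 c4 => h.labelValue_ne d i j (by omega) (by omega))
      have := IntervalPath.glue h.labelValue_periodic hy .R hs rfl rfl (hyX s (by
          rcases hsm with hsm | hsm
          · exact (gap_down s (by omega) (by omega)).2
          · exact (gap_up s (by omega) (by omega)).2)
        (fun j hj => b6 s j hsm (by omega)))
      simpa using this
  rcases ur_cases q hq with hU | ⟨z, a, rfl⟩ | ⟨z, m, a, rfl⟩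
  · obtain ⟨k, hk⟩ : ∃ k, q.length = k + 1 := ⟨q.length - 1, by omega⟩
    obtain ⟨x, hx, hxm⟩ := h.exists_path_up hf hL hw (u := t + w'.length + 1 - n) (v := t - 1)
      (by omega) (by omega) (by omega) (by omega) k (by omega)
    obtain ⟨y, hy, hym⟩ := h.exists_path_down hf' hL' hw' (u := t) (v := t + w'.length)
      (by omega) (by omega) (by omega) (by omega) 0 (by omega)
    obtain rfl : y = t := by omega
    have := IntervalPath.glue h.labelValue_periodic hy .U hx (by ring) (by ring)
      (hYt x (by omega) (by omega))
    rw [hU, hk, List.replicate_succ]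
    simpa using this
  · obtain ⟨h1, h2, h3, h4⟩ := hR _ _ rfl
    simp only [List.length_replicate] at h1 h2
    have := horizontal [] a z (by simp) h1 h2 h3 h4 0 (by simp at hlen; push_cast; omega) []
      (by simp)
    simpa using this
  · obtain ⟨-, h2, h3, h4⟩ := hR _ _ rfl
    obtain ⟨h1, -, -, -⟩ := hR (List.replicate z .U ++ .R :: m) (List.replicate a .U) (by simp)
    simp only [List.length_replicate] at h1 h2
    have := horizontal m a z (fun d hd => hq d (by simp [hd])) h1 h2 h3 h4 (m.length + 1)
      (by simp at hlen; push_cast; omega) (m ++ [.R]) (by simp)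
    simpa using this

/-- A word without `L` is realized if its label at the height of the topmost point is `U`, or
`R` with the bottommost point to the left of the topmost one. -/
lemma exists_path_of_label (h : HullCoords n l t r X Y) {W₁ W₂ : List Dir} {d : Dir}
    (hL₁ : .L ∉ W₁) (hL₂ : .L ∉ W₂) (h₁ : (W₁.length : ℤ) + 1 = t)
    (h₂ : (W₂.length : ℤ) + 1 = n - t) (hd : d = .U ∨ (d = .R ∧ X 0 < X t)) :
    ∃ lo hi v, IntervalPath (labelValue X Y) (W₁ ++ d :: W₂).reverse lo hi v := by
  have htp := h.t_pos
  have htn := h.t_lt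
  obtain ⟨f, -, hf⟩ := h.exists_left_count
  obtain ⟨f', -, hf'⟩ := h.half_turn.exists_left_count
  obtain ⟨x, w, hxw, hw, hx, hxf⟩ := exists_split f W₁.reverse (by simpa using hL₁)
  obtain ⟨x', w', rfl, hw', hx', hxf'⟩ := exists_split f' W₂ hL₂
  have hlen := congrArg List.length hxw
  simp only [List.length_reverse, List.length_append] at hlen h₂
  have e1 := hf t (by omega) htn
  have e2 := hf' (n - t) (by omega) (by omega)
  rw [sub_add_cancel, zero_add, neg_lt_neg_iff, ← zero_add n, h.perX, zero_add] at e2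
  have e3 : (f : ℤ) < t ∧ (f' : ℤ) < n - t ∨ t ≤ f ∧ n - t ≤ f' := by
    rcases lt_or_gt_of_ne (h.injX 0 t htp (by omega)) with hX | hX
    · have := e1.not.1 hX.not_gt
      have := e2.not.1 hX.not_gt
      omega
    · exact .inr ⟨e1.1 hX, e2.1 hX⟩
  have e4 : d = .R → (f : ℤ) < t := by
    rintro rfl
    have hX : X 0 < X t := by simpa using hd
    have := e1.not.1 hX.not_gt
    omega
  have := h.exists_path_of_middle hf hf' (w := w) (w' := w') (q := x'.reverse ++ d :: x)
    (by
      intro hw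
      have : Dir.L ∈ W₁.reverse := by rw [hxw]; simp [hw]
      exact hL₁ (by simpa using this))
    (fun hw => hL₂ (by simp [hw])) hw hw' (by omega) (by push_cast at h₂; omega)
    (by simp; push_cast at h₂; omega)
    (by
      intro e he
      simp only [List.mem_append, List.mem_reverse, List.mem_cons] at he
      rcases he with he | rfl | he
      · exact hx' e he
      · exact hd.imp_right And.left
      · exact hx e he)
    (by
      intro q₂ q₁ hq
      have hle : f ≤ q₁.length + w.length ∧ f' ≤ q₂.length + w'.length := by
        push_cast at h₂
        rcases List.append_eq_append_iff.1 hq with ⟨s, rfl, hs⟩ | ⟨s, hs, hs'⟩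
        · rcases s with _ | ⟨e, s⟩
          · obtain ⟨rfl, rfl⟩ := List.cons.inj hs
            have := e4 rfl
            simp
            omega
          · have := hxf _ _ (List.cons.inj hs).2
            simp
            have := congrArg List.length (List.cons.inj hs).2
            simp at this
            omega
        · rcases s with _ | ⟨e, s⟩
          · obtain ⟨rfl, rfl⟩ := List.cons.inj hs'
            have := e4 rfl
            have := congrArg List.length hs
            simp at this
            omega
          · obtain ⟨rfl, rfl⟩ := List.cons.inj hs'
            have hs2 := congrArg List.reverse hs
            simp at hs2
            have := hxf' _ _ hs2
            have := congrArg List.length hs2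
            simp at this ⊢
            simp at *
            omega
      have := congrArg List.length hq
      simp at this
      push_cast at h₂
      omega)
  have e : (W₁ ++ d :: (x' ++ w')).reverse = w'.reverse ++ (x'.reverse ++ d :: x ++ w) := by
    simp [hxw]
  rwa [e]

/-- Every word without `L` is realized. -/
theorem exists_path (h : HullCoords n l t r X Y) {W : List Dir} (hL : .L ∉ W)
    (hlen : (W.length : ℤ) + 1 = n) :
    ∃ lo hi v, IntervalPath (labelValue X Y) W.reverse lo hi v := by
  have htp := h.t_pos
  have htn := h.t_lt
  obtain ⟨W₁, d, W₂, rfl, h₁⟩ : ∃ W₁ d W₂, W = W₁ ++ d :: W₂ ∧ (W₁.length : ℤ) + 1 = t := by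
    have hk : (t - 1).toNat < W.length := by omega
    refine ⟨W.take (t - 1).toNat, W[(t - 1).toNat], W.drop ((t - 1).toNat + 1), by simp, ?_⟩
    simp
    omega
  simp only [List.length_append, List.length_cons] at hlen
  push_cast at hlen
  simp only [List.mem_append, List.mem_cons, not_or] at hL
  by_cases hd : d = .U ∨ (d = .R ∧ X 0 < X t)
  · exact h.exists_path_of_label hL.1 hL.2.2 h₁ (by omega) hd
  · let φ : Dir → Dir := fun | .U => .D | .D => .U | .L => .L | .R => .R
    have hφ : ∀ l : List Dir, .L ∉ l → .L ∉ l.map φ := by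
      intro l hl hm
      obtain ⟨e, he, hφe⟩ := List.mem_map.1 hm
      cases e <;> simp_all [φ]
    obtain ⟨lo, hi, v, hv⟩ := h.flip.exists_path_of_label (d := φ d) (hφ _ hL.1) (hφ _ hL.2.2)
      (by simpa using h₁) (by simp; omega) (by
        have := h.injX 0 t htp (by omega)
        cases d with
        | U => simp at hd
        | D => simp [φ]
        | L => simp at hL
        | R =>
          simp only [φ, sub_self, sub_zero]
          simp at hd
          exact .inr ⟨trivial, lt_of_le_of_ne hd this.symm⟩)
    have := hv.reflect (G := labelValue X Y) φ t
      (fun d i => by cases d <;> simp [labelValue, φ])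
    have hφφ : φ ∘ φ = id := by funext d; cases d <;> rfl
    have hφd : φ (φ d) = d := congrFun hφφ d
    have hW : ((W₁.map φ ++ φ d :: W₂.map φ).reverse).map φ = (W₁ ++ d :: W₂).reverse := by
      simp [← List.map_reverse, hφφ, hφd]
    exact ⟨_, _, _, hW ▸ this⟩

end HullCoords

lemma IntervalPath.map_labels {F G : Dir → ℤ → ℝ} {w : List Dir} {lo hi v : ℤ}
    (h : IntervalPath F w lo hi v) (φ : Dir → Dir) (hFG : ∀ d i, G (φ d) i = F d i) :
    IntervalPath G (w.map φ) lo hi v := by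
  induction h with
  | single a => exact .single _
  | up d h hd ih => exact ih.up _ (by simpa only [hFG] using hd)
  | down d h hd ih => exact ih.down _ (by simpa only [hFG] using hd)

lemma strictMono_strictAnti_of_no_alternation {n b t : ℤ} {g : ℤ → ℝ}
    (hper : ∀ i, g (i + n) = g i) (hne : ∀ i j, i < j → j < i + n → g i ≠ g j)
    (halt : ∀ i j k m, i < j → j < k → k < m → m < i + n →
      g i < g j → g i < g m → g k < g j → g k < g m → False)
    (hb : ∀ i, g b ≤ g i) (ht : ∀ i, g i ≤ g t) (hbt : b < t) (htb : t < b + n) :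
    (∀ i j, b ≤ i → i < j → j ≤ t → g i < g j) ∧
      ∀ i j, t - n ≤ i → i < j → j ≤ b → g j < g i := by
  refine ⟨fun i j hi hij hj => ?_, ?_⟩
  · have h := hne i j hij (by omega)
    rcases hi.eq_or_lt with rfl | hi
    · exact (hb j).lt_of_ne h
    rcases hj.eq_or_lt with rfl | hj
    · exact (ht i).lt_of_ne h
    by_contra! hlt
    exact halt b i j t hi hij hj htb ((hb i).lt_of_ne (hne b i hi (by omega)))
      ((hb t).lt_of_ne (hne b t hbt htb)) (hlt.lt_of_ne h.symm)
      ((ht j).lt_of_ne (hne j t hj (by omega)))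
  · suffices H : ∀ i j, t ≤ i → i < j → j ≤ b + n → g j < g i by
      intro i j hi hij hj
      simpa only [hper] using H (i + n) (j + n) (by omega) (by omega) (by omega)
    intro i j hi hij hj
    have h := hne i j hij (by omega)
    rcases hi.eq_or_lt with rfl | hi
    · exact (ht j).lt_of_ne h.symm
    rcases hj.eq_or_lt with rfl | hj
    · exact hper b ▸ (hb i).lt_of_ne (hper b ▸ h.symm)
    by_contra! hlt
    exact halt b t i j hbt hi hij hj ((hb t).lt_of_ne (hne b t hbt htb))
      ((hb j).lt_of_ne (hne b j (by omega) hj)) ((ht i).lt_of_ne (hne t i hi (by omega)).symm)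
      (hlt.lt_of_ne h)

/-- `p` enumerates periodically, in clockwise order, `n` points in convex and general
position. -/
structure ClockwiseCycle (n : ℤ) (p : ℤ → ℝ × ℝ) : Prop where
  periodic : ∀ i, p (i + n) = p i
  cross_neg : ∀ i j k, i < j → j < k → k < i + n → cross (p i) (p j) (p k) < 0
  fst_ne : ∀ i j, i < j → j < i + n → (p i).1 ≠ (p j).1
  snd_ne : ∀ i j, i < j → j < i + n → (p i).2 ≠ (p j).2

namespace ClockwiseCycle

variable {n : ℤ} {p : ℤ → ℝ × ℝ}

lemma shift (h : ClockwiseCycle n p) (s : ℤ) : ClockwiseCycle n (fun i => p (i + s)) where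
  periodic i := by rw [← h.periodic (i + s)]; congr 1; ring
  cross_neg i j k hij hjk hki := h.cross_neg _ _ _ (by omega) (by omega) (by omega)
  fst_ne i j hij hji := h.fst_ne _ _ (by omega) (by omega)
  snd_ne i j hij hji := h.snd_ne _ _ (by omega) (by omega)

lemma rotate (h : ClockwiseCycle n p) : ClockwiseCycle n (fun i => (-(p i).2, (p i).1)) where
  periodic i := by simp only [h.periodic]
  cross_neg i j k hij hjk hki := by
    have := h.cross_neg i j k hij hjk hki
    simp only [cross] at this ⊢
    linarith
  fst_ne i j hij hji := fun e => h.snd_ne i j hij hji (neg_injective e)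
  snd_ne i j hij hji := h.fst_ne i j hij hji

lemma no_alternation (h : ClockwiseCycle n p) (f : ℝ × ℝ →ₗ[ℝ] ℝ) (i j k m : ℤ) (hij : i < j)
    (hjk : j < k) (hkm : k < m) (hmi : m < i + n) (h₁ : f (p i) < f (p j))
    (h₂ : f (p i) < f (p m)) (h₃ : f (p k) < f (p j)) (h₄ : f (p k) < f (p m)) : False := by
  have hf : ∀ z, f z = z.1 * f (1, 0) + z.2 * f (0, 1) := by
    intro z
    rw [← smul_eq_mul, ← smul_eq_mul, ← map_smul, ← map_smul, ← map_add]
    simp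
  have cA := h.cross_neg j k m hjk hkm (by omega)
  have cB := h.cross_neg i k m (by omega) hkm hmi
  have cC := h.cross_neg i j m hij (by omega) hmi
  have cD := h.cross_neg i j k hij hjk (by omega)
  have e₁ : cross (p j) (p k) (p m) + cross (p i) (p j) (p m) =
      cross (p i) (p k) (p m) + cross (p i) (p j) (p k) := by
    simp only [cross]; ring
  have e₂ : f (p i) * cross (p j) (p k) (p m) + f (p k) * cross (p i) (p j) (p m) =
      f (p j) * cross (p i) (p k) (p m) + f (p m) * cross (p i) (p j) (p k) := by
    rw [hf (p i), hf (p j), hf (p k), hf (p m)]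
    simp only [cross]
    ring
  obtain ⟨c, hc₁, hc₂⟩ := exists_between (max_lt (lt_min h₁ h₂) (lt_min h₃ h₄))
  obtain ⟨hi, hk⟩ := max_lt_iff.1 hc₁
  obtain ⟨hj, hm⟩ := lt_min_iff.1 hc₂
  linarith [congrArg (c * ·) e₁,
    mul_pos_of_neg_of_neg (sub_neg.2 hi) cA, mul_pos_of_neg_of_neg (sub_neg.2 hk) cC,
    mul_pos_of_neg_of_neg (sub_neg.2 hj) cB, mul_pos_of_neg_of_neg (sub_neg.2 hm) cD]

lemma exists_min {g : ℤ → ℝ} (hn : 0 < n) (hper : ∀ i, g (i + n) = g i) :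
    ∃ b, 0 ≤ b ∧ b < n ∧ ∀ i, g b ≤ g i := by
  obtain ⟨b, hb, hmin⟩ := Finset.exists_min_image (Finset.Ico 0 n) g ⟨0, by simpa⟩
  rw [Finset.mem_Ico] at hb
  refine ⟨b, hb.1, hb.2, fun i => ?_⟩
  have hp : Function.Periodic g n := hper
  have := hmin (i % n) (Finset.mem_Ico.2 ⟨Int.emod_nonneg _ hn.ne', Int.emod_lt_of_pos _ hn⟩)
  have e := hp.sub_zsmul_eq (i / n) (x := i)
  rw [Int.emod_def, mul_comm, ← smul_eq_mul, e] at this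
  exact this

lemma hullCoords (h : ClockwiseCycle n p) (hn : 2 ≤ n) (h₀ : ∀ i, (p 0).2 ≤ (p i).2) :
    ∃ l t r, HullCoords n l t r (fun i => (p i).1) (fun i => (p i).2) := by
  have perX : ∀ i, (p (i + n)).1 = (p i).1 := fun i => by rw [h.periodic]
  have perY : ∀ i, (p (i + n)).2 = (p i).2 := fun i => by rw [h.periodic]
  obtain ⟨t, ht₀, htn, ht⟩ := exists_min (n := n) (g := fun i => -(p i).2) (by omega)
    fun i => by rw [h.periodic]
  obtain ⟨l, hl₀, hln, hl⟩ := exists_min (n := n) (g := fun i => (p i).1) (by omega) perX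
  obtain ⟨r, hr₀, hrn, hr⟩ : ∃ r, 0 < r ∧ r ≤ n ∧ ∀ i, (p i).1 ≤ (p r).1 := by
    obtain ⟨r, hr₀, hrn, hr⟩ := exists_min (n := n) (g := fun i => -(p i).1) (by omega)
      fun i => by rw [h.periodic]
    rcases hr₀.eq_or_lt with rfl | hr₀
    · refine ⟨n, by omega, le_rfl, fun i => ?_⟩
      rw [← zero_add n, h.periodic]
      exact neg_le_neg_iff.1 (hr i)
    · exact ⟨r, hr₀, hrn.le, fun i => neg_le_neg_iff.1 (hr i)⟩
  replace ht : ∀ i, (p i).2 ≤ (p t).2 := fun i => neg_le_neg_iff.1 (ht i)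
  replace ht₀ : 0 < t := by
    rcases ht₀.eq_or_lt with rfl | ht₀
    · exact absurd ((h₀ 1).antisymm (ht 1)) (h.snd_ne 0 1 (by omega) (by omega))
    · exact ht₀
  have hlt : l ≤ t := by
    by_contra! hlt
    have h₁ := h.cross_neg 0 t l ht₀ hlt (by omega)
    have h₂ := (hl 0).lt_of_ne (h.fst_ne 0 l (by omega) (by omega)).symm
    have h₃ := (ht l).lt_of_ne (h.snd_ne t l (by omega) (by omega)).symm
    simp only [cross] at h₁
    nlinarith [mul_pos (sub_pos.2 h₂) (sub_pos.2 h₃), mul_nonneg (sub_nonneg.2 (hl t))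
      (sub_nonneg.2 (h₀ l))]
  have htr : t ≤ r := by
    by_contra! hrt
    have h₁ := h.cross_neg 0 r t hr₀ hrt (by omega)
    have h₂ := (hr 0).lt_of_ne (h.fst_ne 0 r (by omega) (by omega))
    have h₃ := (ht r).lt_of_ne (h.snd_ne r t (by omega) (by omega))
    simp only [cross] at h₁
    nlinarith [mul_pos (sub_pos.2 h₂) (sub_pos.2 h₃), mul_nonneg (sub_nonneg.2 (hr t))
      (sub_nonneg.2 (h₀ r))]
  have hne : ∀ j, (p l).1 = (p r).1 → (p j).1 = (p 0).1 := fun j e =>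
    ((hr j).trans (e ▸ hl 0)).antisymm ((hr 0).trans (e ▸ hl j))
  have hlr : (p l).1 ≠ (p r).1 := fun e =>
    h.fst_ne 0 1 (by omega) (by omega) (hne 1 e).symm
  have hlr₁ : l < r := (hlt.trans htr).lt_of_ne fun e => hlr (by rw [e])
  have hlr₂ : r < l + n := by
    refine lt_of_le_of_ne (by omega) fun e => hlr ?_
    rw [e, h.periodic]
  obtain ⟨hY₁, hY₂⟩ := strictMono_strictAnti_of_no_alternation perY h.snd_ne
    (h.no_alternation (.snd ℝ ℝ ℝ)) h₀ ht ht₀ (by omega)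
  obtain ⟨hX₁, hX₂⟩ := strictMono_strictAnti_of_no_alternation perX h.fst_ne
    (h.no_alternation (.fst ℝ ℝ ℝ)) hl hr hlr₁ hlr₂
  exact ⟨l, t, r, ht₀, htn, hl₀, hlt, htr, hrn, perX, perY, h.fst_ne, h.snd_ne, hY₁, hY₂, hX₁,
    hX₂⟩

lemma exists_hullCoords (h : ClockwiseCycle n p) (hn : 2 ≤ n) :
    ∃ s l t r, HullCoords n l t r (fun i => (p (i + s)).1) (fun i => (p (i + s)).2) := by
  obtain ⟨s, -, -, hs⟩ := exists_min (n := n) (g := fun i => (p i).2) (by omega)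
    fun i => by rw [h.periodic]
  exact ⟨s, (h.shift s).hullCoords hn fun i => by simpa only [zero_add] using hs (i + s)⟩

lemma exists_intervalPath_of_left (h : ClockwiseCycle n p) {W : List Dir} (hW : .L ∉ W)
    (hlen : (W.length : ℤ) + 1 = n) (hn : 2 ≤ n) :
    ∃ lo hi v,
      IntervalPath (labelValue (fun i => (p i).1) (fun i => (p i).2)) W.reverse lo hi v := by
  obtain ⟨s, l, t, r, hc⟩ := h.exists_hullCoords hn
  obtain ⟨lo, hi, v, hv⟩ := hc.exists_path hW hlen
  exact ⟨_, _, _, hv.shift s fun d i => by cases d <;> rfl⟩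

lemma exists_intervalPath_of_rot {x : Dir}
    (ih : ∀ {p : ℤ → ℝ × ℝ}, ClockwiseCycle n p → ∀ {W : List Dir}, x.rot ∉ W →
      (W.length : ℤ) + 1 = n → ∃ lo hi v,
        IntervalPath (labelValue (fun i => (p i).1) (fun i => (p i).2)) W.reverse lo hi v)
    (h : ClockwiseCycle n p) {W : List Dir} (hW : x ∉ W) (hlen : (W.length : ℤ) + 1 = n) :
    ∃ lo hi v,
      IntervalPath (labelValue (fun i => (p i).1) (fun i => (p i).2)) W.reverse lo hi v := by
  have hrot : ∀ d : Dir, d.rot.rot.rot.rot = d := fun d => by cases d <;> rfl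
  obtain ⟨lo, hi, v, hv⟩ := ih h.rotate (W := W.map Dir.rot)
    (fun hm => by
      obtain ⟨y, hy, e⟩ := List.mem_map.1 hm
      exact hW (by rwa [← hrot x, ← e, hrot])) (by simpa using hlen)
  have := hv.map_labels (G := labelValue (fun i => (p i).1) (fun i => (p i).2))
    (fun d => d.rot.rot.rot) (fun d i => by cases d <;> simp [labelValue, Dir.rot])
  refine ⟨lo, hi, v, ?_⟩
  rwa [← List.map_reverse, List.map_map, show (fun d : Dir => d.rot.rot.rot) ∘ Dir.rot = id from
    funext hrot, List.map_id] at this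

lemma exists_intervalPath (h : ClockwiseCycle n p) {x : Dir} {W : List Dir} (hW : x ∉ W)
    (hlen : (W.length : ℤ) + 1 = n) (hn : 2 ≤ n) :
    ∃ lo hi v,
      IntervalPath (labelValue (fun i => (p i).1) (fun i => (p i).2)) W.reverse lo hi v := by
  have hL {p : ℤ → ℝ × ℝ} (h : ClockwiseCycle n p) {W : List Dir} (hW : .L ∉ W)
    (hlen : (W.length : ℤ) + 1 = n) := h.exists_intervalPath_of_left hW hlen hn
  have hU {p : ℤ → ℝ × ℝ} (h : ClockwiseCycle n p) {W : List Dir} (hW : .U ∉ W)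
    (hlen : (W.length : ℤ) + 1 = n) := exists_intervalPath_of_rot (x := .U) hL h hW hlen
  have hR {p : ℤ → ℝ × ℝ} (h : ClockwiseCycle n p) {W : List Dir} (hW : .R ∉ W)
    (hlen : (W.length : ℤ) + 1 = n) := exists_intervalPath_of_rot (x := .R) hU h hW hlen
  cases x with
  | L => exact hL h hW hlen
  | U => exact hU h hW hlen
  | R => exact hR h hW hlen
  | D => exact exists_intervalPath_of_rot (x := .D) hR h hW hlen

end ClockwiseCycle

lemma cross_rotate (a b c : ℝ × ℝ) : cross b c a = cross a b c := by
  simp only [cross]; ring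

lemma ClockwiseCycle.of_list {n : ℕ} (hn : 0 < n) {c : ℕ → ℝ × ℝ}
    (hcross : ∀ i j k, i < j → j < k → k < n → cross (c i) (c j) (c k) < 0)
    (hne : ∀ i j, i < j → j < n → (c i).1 ≠ (c j).1 ∧ (c i).2 ≠ (c j).2) :
    ClockwiseCycle n (fun i => c (i % n).toNat) := by
  set p : ℤ → ℝ × ℝ := fun i => c (i % n).toNat with hp
  have hper : Function.Periodic p n := fun i => by simp [hp]
  have hn' : (0 : ℤ) < n := by exact_mod_cast hn
  have hlow (i : ℤ) (h₀ : 0 ≤ i) (h₁ : i < n) : p i = c i.toNat := by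
    simp only [hp, Int.emod_eq_of_lt h₀ h₁]
  have hhigh (i : ℤ) (h₀ : n ≤ i) (h₁ : i < n + n) : p i = c (i - n).toNat := by
    rw [← hlow _ (by omega) (by omega), hper.sub_eq]
  have hred (i : ℤ) : ∃ s : ℤ, 0 ≤ i - s ∧ i - s < n ∧ ∀ j, p (j - s) = p j :=
    ⟨(i / n) • (n : ℤ), by
      rw [smul_eq_mul, mul_comm, ← Int.emod_def]; exact Int.emod_nonneg _ hn'.ne', by
      rw [smul_eq_mul, mul_comm, ← Int.emod_def]; exact Int.emod_lt_of_pos _ hn',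
      fun j => hper.sub_zsmul_eq _⟩
  have hne' (i j : ℤ) (hij : i < j) (hji : j < i + n) :
      (p i).1 ≠ (p j).1 ∧ (p i).2 ≠ (p j).2 := by
    obtain ⟨s, h₀, h₁, hs⟩ := hred i
    rw [← hs i, ← hs j, hlow (i - s) h₀ h₁]
    rcases lt_or_ge (j - s) n with hj | hj
    · rw [hlow (j - s) (by omega) hj]
      exact hne _ _ (by omega) (by omega)
    · rw [hhigh (j - s) hj (by omega)]
      exact (hne (j - s - n).toNat (i - s).toNat (by omega) (by omega)).imp .symm .symm
  refine ⟨hper, fun i j k hij hjk hki => ?_, fun i j hij hji => (hne' i j hij hji).1,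
    fun i j hij hji => (hne' i j hij hji).2⟩
  obtain ⟨s, h₀, h₁, hs⟩ := hred i
  rw [← hs i, ← hs j, ← hs k, hlow (i - s) h₀ h₁]
  rcases lt_or_ge (k - s) n with hk | hk
  · rw [hlow (j - s) (by omega) (by omega), hlow (k - s) (by omega) (by omega)]
    exact hcross _ _ _ (by omega) (by omega) (by omega)
  rw [hhigh (k - s) (by omega) (by omega)]
  rcases lt_or_ge (j - s) n with hj | hj
  · rw [hlow (j - s) (by omega) (by omega), cross_rotate]
    exact hcross _ _ _ (by omega) (by omega) (by omega)
  · rw [hhigh (j - s) (by omega) (by omega), ← cross_rotate]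
    exact hcross _ _ _ (by omega) (by omega) (by omega)

lemma ConvexPos.cross_neg {S : Set (ℝ × ℝ)} (hS : ConvexPos S) {b x y z : ℝ × ℝ} (hb : b ∈ S)
    (hx : x ∈ S) (hy : y ∈ S) (hz : z ∈ S) (hxy : cross b x y < 0) (hyz : cross b y z < 0)
    (hxz : cross b x z < 0) : cross x y z < 0 := by
  by_contra! hle
  refine (convexIndependent_set_iff_notMem_convexHull_sdiff.1 hS) y hy ?_
  have hmem : ∀ u ∈ S, u ≠ y → u ∈ convexHull ℝ (S \ {y}) := fun u hu hne =>
    subset_convexHull ℝ _ ⟨hu, hne⟩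
  have hb' := hmem b hb (by rintro rfl; simp [cross] at hyz)
  have hx' := hmem x hx (by rintro rfl; simp [cross, mul_comm] at hxy)
  have hz' := hmem z hz (by rintro rfl; simp [cross, mul_comm] at hyz)
  set D := cross b x z with hD
  have hsum : cross y x z / D + cross b y z / D + cross b x y / D = 1 := by
    rw [← add_div, ← add_div, div_eq_one_iff_eq hxz.ne, hD]
    simp only [cross]; ring
  have hy' : y = (cross y x z / D) • b + (cross b y z / D) • x + (cross b x y / D) • z := by
    have hD0 : D ≠ 0 := hxz.ne
    ext
    · simp only [Prod.fst_add, Prod.smul_fst, smul_eq_mul]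
      field_simp
      rw [hD]; simp only [cross]; ring
    · simp only [Prod.snd_add, Prod.smul_snd, smul_eq_mul]
      field_simp
      rw [hD]; simp only [cross]; ring
  have hyx : cross y x z ≤ 0 := by
    have : cross y x z = -cross x y z := by simp only [cross]; ring
    linarith
  have := (convex_convexHull ℝ (S \ {y})).sum_mem (t := Finset.univ)
    (w := ![cross y x z / D, cross b y z / D, cross b x y / D]) (z := ![b, x, z])
    (by
      intro i _
      fin_cases i
      · exact div_nonneg_of_nonpos hyx hxz.le
      · exact div_nonneg_of_nonpos hyz.le hxz.le
      · exact div_nonneg_of_nonpos hxy.le hxz.le)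
    (by simpa [Fin.sum_univ_three] using hsum)
    (by intro i _; fin_cases i <;> assumption)
  simpa [Fin.sum_univ_three, ← hy'] using this

lemma exists_clockwiseCycle {m : ℕ} {S : Set (ℝ × ℝ)} (hfin : S.Finite)
    (hcard : S.ncard = m + 1) (hconv : ConvexPos S) (hgen : GenPos S) :
    ∃ p, ClockwiseCycle (m + 1) p ∧ ∀ i, p i ∈ S := by
  obtain ⟨b, hb, hmin⟩ := S.exists_min_image Prod.snd hfin
    (Set.nonempty_of_ncard_ne_zero (by omega))
  let F := hfin.toFinset.erase b
  have hF : ∀ q, q ∈ F ↔ q ≠ b ∧ q ∈ S := by simp [F]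
  have hpos : ∀ q ∈ F, 0 < q.2 - b.2 := fun q hq => by
    obtain ⟨hqb, hq⟩ := (hF q).1 hq
    exact sub_pos.2 ((hmin q hq).lt_of_ne (hgen.2 q hq b hb hqb).2.symm)
  have hFcard : F.card = m := by
    rw [Finset.card_erase_of_mem (by simpa using hb), ← Set.ncard_eq_toFinset_card S hfin, hcard]
    rfl
  let κ : ℝ × ℝ → ℝ := fun q => (q.1 - b.1) / (q.2 - b.2)
  have hκ : Set.InjOn κ F := by
    intro q hq s hs hqs
    by_contra hne
    obtain ⟨hqb, hqS⟩ := (hF q).1 hq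
    obtain ⟨hsb, hsS⟩ := (hF s).1 hs
    refine hgen.1 b hb q hqS s hsS hqb.symm hsb.symm hne ?_
    have hline : ∀ z ∈ F, z = (z.2 - b.2) • (κ z, (1 : ℝ)) + b := fun z hz => by
      have := (hpos z hz).ne'
      ext <;> simp [κ, mul_div_cancel₀ _ this]
    rw [collinear_iff_of_mem (Set.mem_insert b _)]
    refine ⟨(κ q, 1), ?_⟩
    simp only [Set.mem_insert_iff, Set.mem_singleton_iff, vadd_eq_add]
    rintro z (rfl | rfl | rfl)
    · exact ⟨0, by simp⟩
    · exact ⟨_, hline _ hq⟩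
    · exact ⟨_, hqs ▸ hline _ hs⟩
  have hκcard : (F.image κ).card = m := by rw [Finset.card_image_of_injOn hκ, hFcard]
  have hg : ∀ i : Fin m, ∃ q ∈ F, κ q = (F.image κ).orderEmbOfFin hκcard i := fun i =>
    Finset.mem_image.1 (Finset.orderEmbOfFin_mem _ hκcard i)
  choose e he hge using hg
  let c : ℕ → ℝ × ℝ := fun k => if h : k - 1 < m ∧ 0 < k then e ⟨k - 1, h.1⟩ else b
  have hcF : ∀ k, 0 < k → k < m + 1 → c k ∈ F := fun k h₀ h₁ => by
    simp only [c, dif_pos (show k - 1 < m ∧ 0 < k by omega)]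
    exact he _
  have hc₀ : c 0 = b := by simp [c]
  have hcS : ∀ k, c k ∈ S := fun k => by
    by_cases h : k - 1 < m ∧ 0 < k
    · exact ((hF _).1 (hcF k h.2 (by omega))).2
    · simp only [c, dif_neg h, hb]
  have hcb : ∀ j k, 0 < j → j < k → k < m + 1 → cross b (c j) (c k) < 0 := by
    intro j k hj hjk hk
    have hlt : κ (c j) < κ (c k) := by
      simp only [c, dif_pos (show j - 1 < m ∧ 0 < j by omega),
        dif_pos (show k - 1 < m ∧ 0 < k by omega), hge]
      exact (OrderEmbedding.strictMono _) (Fin.mk_lt_mk.2 (by omega))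
    have := (div_lt_div_iff₀ (hpos _ (hcF j hj (by omega))) (hpos _ (hcF k (by omega) hk))).1 hlt
    simp only [cross]
    linarith
  have hcne : ∀ j k, j < k → k < m + 1 → c j ≠ c k := by
    intro j k hjk hk
    rcases j.eq_zero_or_pos with rfl | hj
    · exact hc₀ ▸ ((hF _).1 (hcF k hjk hk)).1.symm
    · intro e
      have := hcb j k hj hjk hk
      simp [e, cross, mul_comm] at this
  refine ⟨_, mod_cast ClockwiseCycle.of_list (c := c) m.succ_pos ?_ fun i j hij hj =>
    hgen.2 _ (hcS i) _ (hcS j) (hcne i j hij hj), fun i => hcS _⟩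
  intro i j k hij hjk hk
  rcases i.eq_zero_or_pos with rfl | hi
  · exact hc₀ ▸ hcb j k hij hjk hk
  · exact hconv.cross_neg hb (hcS i) (hcS j) (hcS k) (hcb i j hi hij (hjk.trans hk))
      (hcb j k (hi.trans hij) hjk hk) (hcb i k hi (hij.trans hjk) hk)

lemma cross_lineMap (a b x y : ℝ × ℝ) (s t : ℝ) (hst : s + t = 1) :
    cross a b (s • x + t • y) = s * cross a b x + t * cross a b y := by
  obtain rfl : s = 1 - t := by linarith
  simp only [cross, Prod.fst_add, Prod.smul_fst, Prod.snd_add, Prod.smul_snd, smul_eq_mul]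
  ring

lemma cross_eq_zero_of_mem_segment {a b z : ℝ × ℝ} (hz : z ∈ segment ℝ a b) :
    cross a b z = 0 := by
  obtain ⟨s, t, -, -, hst, rfl⟩ := hz
  rw [cross_lineMap a b a b s t hst]
  simp only [cross]; ring

lemma segment_inter_eq_empty {a b x y : ℝ × ℝ} (hx : cross a b x < 0) (hy : cross a b y < 0) :
    segment ℝ a b ∩ segment ℝ x y = ∅ := by
  refine Set.eq_empty_iff_forall_notMem.2 fun z ⟨hab, hxy⟩ => ?_
  have h₀ := cross_eq_zero_of_mem_segment hab
  obtain ⟨s, t, hs, ht, hst, rfl⟩ := hxy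
  rw [cross_lineMap a b x y s t hst] at h₀
  rcases hs.eq_or_lt with rfl | hs
  · obtain rfl : t = 1 := by linarith
    linarith
  · nlinarith [mul_neg_of_pos_of_neg hs hx, mul_nonpos_of_nonneg_of_nonpos ht hy.le]

lemma segment_inter_eq_singleton {a b c : ℝ × ℝ} (h : cross a b c ≠ 0) :
    segment ℝ a b ∩ segment ℝ b c = {b} := by
  refine Set.Subset.antisymm (fun z ⟨hab, hbc⟩ => ?_) ?_
  · have h₀ := cross_eq_zero_of_mem_segment hab
    obtain ⟨s, t, hs, ht, hst, rfl⟩ := hbc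
    have hb : cross a b b = 0 := cross_eq_zero_of_mem_segment (right_mem_segment ℝ a b)
    rw [cross_lineMap a b b c s t hst, hb, mul_zero, zero_add] at h₀
    obtain rfl : t = 0 := (mul_eq_zero.1 h₀).resolve_right h
    obtain rfl : s = 1 := by linarith
    simp
  · rw [Set.singleton_subset_iff]
    exact ⟨right_mem_segment ℝ a b, left_mem_segment ℝ b c⟩

namespace ClockwiseCycle

variable {n : ℤ} {p : ℤ → ℝ × ℝ}

lemma cross_neg_of_outside (h : ClockwiseCycle n p) {lo u v x : ℤ} (huv : u < v) (hu : lo ≤ u)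
    (hv : v < lo + n) (hx₀ : lo ≤ x) (hx₁ : x < lo + n) (hx : x < u ∨ v < x) :
    cross (p u) (p v) (p x) < 0 := by
  rcases hx with hx | hx
  · rw [cross_rotate]
    exact h.cross_neg x u v hx huv (by omega)
  · exact h.cross_neg u v x huv hx (by omega)

lemma segment_inter_eq_empty (h : ClockwiseCycle n p) {lo u v x y : ℤ} (huv : u ≠ v)
    (hu₀ : lo ≤ u) (hu₁ : u < lo + n) (hv₀ : lo ≤ v) (hv₁ : v < lo + n)
    (hx₀ : lo ≤ x) (hx₁ : x < lo + n) (hy₀ : lo ≤ y) (hy₁ : y < lo + n)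
    (hx : x < min u v ∨ max u v < x) (hy : y < min u v ∨ max u v < y) :
    segment ℝ (p u) (p v) ∩ segment ℝ (p x) (p y) = ∅ := by
  rcases huv.lt_or_gt with huv | huv
  · exact _root_.segment_inter_eq_empty
      (h.cross_neg_of_outside huv hu₀ hv₁ hx₀ hx₁ (by omega))
      (h.cross_neg_of_outside huv hu₀ hv₁ hy₀ hy₁ (by omega))
  · rw [segment_symm]
    exact _root_.segment_inter_eq_empty
      (h.cross_neg_of_outside huv hv₀ hu₁ hx₀ hx₁ (by omega))
      (h.cross_neg_of_outside huv hv₀ hu₁ hy₀ hy₁ (by omega))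

lemma cross_ne_zero (h : ClockwiseCycle n p) {lo u v x : ℤ} (huv : u ≠ v) (hxu : x ≠ u)
    (hxv : x ≠ v) (hu₀ : lo ≤ u) (hu₁ : u < lo + n) (hv₀ : lo ≤ v) (hv₁ : v < lo + n)
    (hx₀ : lo ≤ x) (hx₁ : x < lo + n) : cross (p u) (p v) (p x) ≠ 0 := by
  have key : ∀ a b c, lo ≤ a → a < b → b < c → c < lo + n → cross (p a) (p b) (p c) < 0 :=
    fun a b c h₁ h₂ h₃ h₄ => h.cross_neg a b c h₂ h₃ (by omega)
  have hrev : cross (p v) (p u) (p x) = -cross (p u) (p v) (p x) := by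
    simp only [cross]; ring
  rcases huv.lt_or_gt with huv | huv
  · rcases lt_or_ge x u with hx | hx
    · rw [cross_rotate]; exact (key _ _ _ hx₀ hx huv hv₁).ne
    rcases lt_or_ge x v with hx' | hx'
    · rw [← neg_ne_zero, ← hrev, ← cross_rotate]
      exact (key _ _ _ hu₀ (by omega) hx' hv₁).ne
    · exact (key _ _ _ hu₀ huv (by omega) hx₁).ne
  · rw [← neg_ne_zero, ← hrev]
    rcases lt_or_ge x v with hx | hx
    · rw [cross_rotate]; exact (key _ _ _ hx₀ hx huv hu₁).ne
    rcases lt_or_ge x u with hx' | hx'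
    · rw [← neg_ne_zero]
      rw [hrev, neg_neg, ← cross_rotate]
      exact (key _ _ _ hv₀ (by omega) hx' hu₁).ne
    · exact (key _ _ _ hv₀ huv (by omega) hx₁).ne

end ClockwiseCycle

lemma dirOk_of_labelValue_lt {p : ℤ → ℝ × ℝ} {d : Dir} {u v : ℤ}
    (h : labelValue (fun i => (p i).1) (fun i => (p i).2) d u <
      labelValue (fun i => (p i).1) (fun i => (p i).2) d v) : dirOk d (p u) (p v) := by
  cases d <;> simpa [labelValue, dirOk] using h

/-- every three-directional path admits a PDCE on every convex point set in
general position. -/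
theorem threeDirectional_pdce {m : ℕ} (d : Fin m → Dir)
    (hd : ∃ x : Dir, ∀ i, d i ≠ x) (S : Set (ℝ × ℝ)) (hfin : S.Finite)
    (hcard : S.ncard = m + 1) (hconv : ConvexPos S) (hgen : GenPos S) :
    ∃ E : Fin (m + 1) → ℝ × ℝ, PDCE d E S := by
  obtain ⟨x, hx⟩ := hd
  obtain ⟨p, hp, hpS⟩ := exists_clockwiseCycle hfin hcard hconv hgen
  obtain ⟨lo, hi, v, hv⟩ : ∃ lo hi v,
      IntervalPath (labelValue (fun i => (p i).1) (fun i => (p i).2)) (List.ofFn d).reverse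
        lo hi v := by
    rcases m.eq_zero_or_pos with rfl | hm
    · exact ⟨0, 0, 0, by simpa using IntervalPath.single 0⟩
    · exact hp.exists_intervalPath (x := x) (by simpa [List.mem_ofFn] using hx) (by simp)
        (by omega)
  obtain ⟨-, -, hlen⟩ := hv.bounds
  obtain ⟨q, -, hq, hpre, hlt⟩ := hv.exists_enumeration
  simp only [List.length_reverse, List.length_ofFn] at hlen hq hpre
  have hinj : ∀ i j, i < j → j ≤ m → q i ≠ q j := by
    intro i j hij hj e
    obtain ⟨a, b, hab⟩ := hpre i (by omega)
    have := (hab i (by omega)).2 le_rfl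
    have := (hab j hj).1 (e ▸ this)
    omega
  have hwin : ∀ i ≤ m, lo ≤ q i ∧ q i < lo + (m + 1) := fun i hi => by
    have := hq i hi
    omega
  have hE : Function.Injective fun i : Fin (m + 1) => p (q i) := by
    have key : ∀ i j, i < j → j ≤ m → p (q i) ≠ p (q j) := by
      intro i j hij hj e
      have h₁ := hwin i (by omega)
      have h₂ := hwin j hj
      rcases (hinj i j hij hj).lt_or_gt with h | h
      · exact hp.fst_ne _ _ h (by omega) (by rw [e])
      · exact hp.fst_ne _ _ h (by omega) (by rw [e])
    intro i j e
    by_contra hne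
    rcases (Fin.val_ne_of_ne hne).lt_or_gt with h | h
    · exact key i j h (by omega) e
    · exact key j i h (by omega) e.symm
  refine ⟨fun i => p (q i), ⟨hE, ?_⟩, fun i => ?_, fun i j hij => ?_, fun i j hij => ?_⟩
  · refine Set.eq_of_subset_of_ncard_le (Set.range_subset_iff.2 fun i => hpS _) ?_ hfin
    rw [← Set.image_univ, Set.ncard_image_of_injective _ hE, Set.ncard_univ, hcard]
    simp
  · have := hlt i (by simp)
    exact dirOk_of_labelValue_lt (by simpa using this)
  · obtain ⟨a, b, hab⟩ := hpre (i + 1) (by omega)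
    have h₁ := hab i (by omega)
    have h₂ := hab (i + 1) (by omega)
    have h₃ := hab j (by omega)
    have h₄ := hab (j + 1) (by omega)
    simp only [Fin.val_castSucc, Fin.val_succ]
    have w₁ := hwin i (by omega)
    have w₂ := hwin (i + 1) (by omega)
    have w₃ := hwin j (by omega)
    have w₄ := hwin (j + 1) (by omega)
    exact hp.segment_inter_eq_empty (hinj _ _ (Nat.lt_succ_self _) (by omega)) w₁.1 w₁.2 w₂.1 w₂.2
      w₃.1 w₃.2 w₄.1 w₄.2 (by omega) (by omega)
  · have w₁ := hwin i (by omega)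
    have w₂ := hwin (i + 1) (by omega)
    have w₃ := hwin (i + 1 + 1) (by omega)
    simp only [Fin.val_castSucc, Fin.val_succ, ← hij]
    exact segment_inter_eq_singleton (hp.cross_ne_zero (hinj _ _ (by omega) (by omega))
      (hinj _ _ (by omega) (by omega)).symm (hinj _ _ (by omega) (by omega)).symm
      w₁.1 w₁.2 w₂.1 w₂.2 w₃.1 w₃.2)
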